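/- Equivalence of von Koch–level bounds: if ψ(x) − x ≪ x^{1/2}·log x as x → ∞, then π(x) − Li(x) ≪ x^{1/2}·log x; conversely if π(x) − Li(x) ≪ x^{1/2}·log x then ψ(x) − x ≪ x^{1/2}·(log x)². -/

import Mathlib

open Finset

noncomputable def psi (t : ℝ) : ℝ :=
  ∑ n ∈ Finset.Icc 1 ⌊t⌋₊, ArithmeticFunction.vonMangoldt n

noncomputable def primeCnt (x : ℝ) : ℕ := Nat.primeCounting ⌊x⌋₊

noncomputable def Li (x : ℝ) : ℝ := ∫ t in (2:ℝ)..x, 1 / Real.log t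

open MeasureTheory

theorem psi_eq_chebyshev_psi (x : ℝ) : psi x = Chebyshev.psi x := rfl

/-- A function of at most linear growth on `[2, ∞)` that is eventually `≪ √x log x` is bounded by a
multiple of `√x log x` on all of `[2, ∞)`. -/
theorem exists_forall_two_le_abs_le {f : ℝ → ℝ} {A : ℝ} (hA : ∀ t, 2 ≤ t → |f t| ≤ A * t)
    (h : ∃ C : ℝ, 0 < C ∧ ∃ x₀ : ℝ, ∀ x, x₀ ≤ x → |f x| ≤ C * x ^ ((1:ℝ)/2) * Real.log x) :
    ∃ K : ℝ, 0 < K ∧ ∀ t, 2 ≤ t → |f t| ≤ K * √t * Real.log t := by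
  obtain ⟨C, hC, x₀, hx₀⟩ := h
  have hl : 0 < Real.log 2 := Real.log_pos one_lt_two
  have hA0 : 0 ≤ A := by linarith [(abs_nonneg _).trans (hA 2 le_rfl)]
  refine ⟨C + A * |x₀| / Real.log 2, by positivity, fun t ht ↦ ?_⟩
  have hlt : Real.log 2 ≤ Real.log t := Real.log_le_log two_pos ht
  have hs : 1 ≤ √t := Real.one_le_sqrt.mpr (by linarith)
  have hlt0 : 0 < Real.log t := hl.trans_le hlt
  rcases le_total x₀ t with h | h
  · refine (hx₀ t h).trans ?_
    rw [← Real.sqrt_eq_rpow]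
    gcongr
    have : 0 ≤ A * |x₀| / Real.log 2 := by positivity
    linarith
  · calc |f t| ≤ A * t := hA t ht
      _ ≤ A * |x₀| := by gcongr; exact h.trans (le_abs_self _)
      _ = A * |x₀| / Real.log 2 * 1 * Real.log 2 := by field_simp
      _ ≤ (C + A * |x₀| / Real.log 2) * √t * Real.log t := by
        gcongr
        linarith

theorem abs_integral_le_two_mul_sqrt {g : ℝ → ℝ} {M x : ℝ} (hM : 0 ≤ M) (hx : 2 ≤ x)
    (hg : ∀ t, 2 ≤ t → t ≤ x → |g t| ≤ M / √t) : |∫ t in (2:ℝ)..x, g t| ≤ 2 * M * √x := by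
  have h_int : ∀ r : ℝ, -1 < r → IntervalIntegrable (fun t : ℝ ↦ M * t ^ r) volume 2 x :=
    fun r hr ↦ (intervalIntegral.intervalIntegrable_rpow' hr).const_mul M
  have key := intervalIntegral.norm_integral_le_of_norm_le (f := g) (μ := volume) hx
    (g := fun t ↦ M * t ^ (-(1 / 2) : ℝ)) (ae_of_all _ fun t ht ↦ ?_) (h_int _ (by norm_num))
  · rw [Real.norm_eq_abs, intervalIntegral.integral_const_mul,
      integral_rpow (Or.inl (by norm_num)), show (-(1 / 2) + 1 : ℝ) = 1 / 2 by norm_num,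
      ← Real.sqrt_eq_rpow, ← Real.sqrt_eq_rpow] at key
    refine key.trans ?_
    have : 0 ≤ M * √2 := by positivity
    linarith
  · rw [Real.norm_eq_abs]
    refine (hg t ht.1.le ht.2).trans_eq ?_
    rw [Real.rpow_neg (by linarith [ht.1]), ← Real.sqrt_eq_rpow, div_eq_mul_inv]

theorem intervalIntegrable_inv_log {a b : ℝ} (ha : 1 < a) (hb : 1 < b) :
    IntervalIntegrable (fun t ↦ 1 / Real.log t) volume a b := by
  refine ContinuousOn.intervalIntegrable fun t ht ↦ ContinuousAt.continuousWithinAt ?_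
  have h1 : 1 < t := (lt_min ha hb).trans_le ht.1
  have : t ≠ 0 := by linarith
  have : Real.log t ≠ 0 := (Real.log_pos h1).ne'
  fun_prop

theorem hasDerivAt_Li {x : ℝ} (hx : 1 < x) : HasDerivAt Li (1 / Real.log x) x := by
  have : x ≠ 0 := by linarith
  have hl : Real.log x ≠ 0 := (Real.log_pos hx).ne'
  have hc : ContinuousAt (fun t ↦ 1 / Real.log t) x := by fun_prop
  refine intervalIntegral.integral_hasDerivAt_right (intervalIntegrable_inv_log one_lt_two hx)
    ?_ hc
  have : Measurable fun t ↦ 1 / Real.log t := by fun_prop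
  exact this.stronglyMeasurable.stronglyMeasurableAtFilter

theorem Li_two : Li 2 = 0 := intervalIntegral.integral_same

theorem continuousOn_Li : ContinuousOn Li (Set.Ioi 1) :=
  fun _ hx ↦ (hasDerivAt_Li hx).continuousAt.continuousWithinAt

theorem Li_nonneg {x : ℝ} (hx : 2 ≤ x) : 0 ≤ Li x :=
  intervalIntegral.integral_nonneg hx fun t ht ↦
    one_div_nonneg.mpr (Real.log_nonneg (by linarith [ht.1]))

theorem Li_le {x : ℝ} (hx : 2 ≤ x) : Li x ≤ 1 / Real.log 2 * x := by
  have hl : 0 < Real.log 2 := Real.log_pos one_lt_two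
  calc Li x ≤ ∫ _ in (2:ℝ)..x, 1 / Real.log 2 := by
        refine intervalIntegral.integral_mono_on hx
          (intervalIntegrable_inv_log one_lt_two (by linarith)) (by simp) fun t ht ↦ ?_
        gcongr
        exact ht.1
    _ = 1 / Real.log 2 * (x - 2) := by simp [mul_comm]
    _ ≤ 1 / Real.log 2 * x := by gcongr; linarith

theorem Li_eq_div_log_add_integral {x : ℝ} (hx : 2 ≤ x) :
    Li x = x / Real.log x - 2 / Real.log 2 + ∫ t in (2:ℝ)..x, 1 / Real.log t ^ 2 := by
  have h1 := intervalIntegrable_inv_log one_lt_two (show 1 < x by linarith)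
  have h2 := Chebyshev.intervalIntegrable_one_div_log_sq one_lt_two (show 1 < x by linarith)
  have := intervalIntegral.integral_eq_sub_of_hasDerivAt (f := fun t ↦ t / Real.log t)
    (f' := fun t ↦ 1 / Real.log t - 1 / Real.log t ^ 2) (fun t ht ↦ ?_) (h1.sub h2)
  · rw [intervalIntegral.integral_sub h1 h2] at this
    rw [Li]
    linarith
  · rw [Set.uIcc_of_le hx] at ht
    have ht0 : t ≠ 0 := by linarith [ht.1]
    have hl : Real.log t ≠ 0 := (Real.log_pos (by linarith [ht.1])).ne'
    refine ((hasDerivAt_id t).div (Real.hasDerivAt_log ht0) hl).congr_deriv ?_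
    simp only [id]
    field_simp

theorem intervalIntegrable_Li_div {x : ℝ} (hx : 2 ≤ x) :
    IntervalIntegrable (fun t ↦ Li t / t) volume 2 x := by
  refine ContinuousOn.intervalIntegrable ?_
  rw [Set.uIcc_of_le hx]
  refine (continuousOn_Li.mono fun t ht ↦ ?_).div continuousOn_id fun t ht ↦ ?_
  · exact one_lt_two.trans_le ht.1
  · exact (two_pos.trans_le ht.1).ne'

theorem Li_mul_log_eq {x : ℝ} (hx : 2 ≤ x) :
    Li x * Real.log x = x - 2 + ∫ t in (2:ℝ)..x, Li t / t := by
  have h2 := intervalIntegrable_Li_div hx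
  have h1 : IntervalIntegrable (fun _ : ℝ ↦ (1 : ℝ)) volume 2 x := by simp
  have := intervalIntegral.integral_eq_sub_of_hasDerivAt (f := fun t ↦ Li t * Real.log t)
    (f' := fun t ↦ 1 + Li t / t) (fun t ht ↦ ?_) (h1.add h2)
  · rw [intervalIntegral.integral_add h1 h2, Li_two] at this
    simp at this
    linarith
  · rw [Set.uIcc_of_le hx] at ht
    have ht0 : t ≠ 0 := by linarith [ht.1]
    have hl : Real.log t ≠ 0 := (Real.log_pos (by linarith [ht.1])).ne'
    refine ((hasDerivAt_Li (by linarith [ht.1])).mul (Real.hasDerivAt_log ht0)).congr_deriv ?_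
    field_simp

theorem primeCnt_sub_Li_eq {x : ℝ} (hx : 2 ≤ x) :
    (primeCnt x : ℝ) - Li x = (Chebyshev.theta x - x) / Real.log x + 2 / Real.log 2 +
      ∫ t in (2:ℝ)..x, (Chebyshev.theta t - t) / (t * Real.log t ^ 2) := by
  have h2 := Chebyshev.intervalIntegrable_one_div_log_sq one_lt_two (show 1 < x by linarith)
  have h1 : IntervalIntegrable (fun t ↦ Chebyshev.theta t / (t * Real.log t ^ 2)) volume 2 x :=
    (intervalIntegrable_iff_integrableOn_Icc_of_le hx).mpr
      (Chebyshev.integrableOn_theta_div_id_mul_log_sq x)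
  have : ∫ t in (2:ℝ)..x, (Chebyshev.theta t - t) / (t * Real.log t ^ 2) =
      (∫ t in (2:ℝ)..x, Chebyshev.theta t / (t * Real.log t ^ 2)) -
        ∫ t in (2:ℝ)..x, 1 / Real.log t ^ 2 := by
    rw [← intervalIntegral.integral_sub h1 h2]
    refine intervalIntegral.integral_congr fun t ht ↦ ?_
    rw [Set.uIcc_of_le hx] at ht
    have ht0 : t ≠ 0 := by linarith [ht.1]
    have hl : Real.log t ≠ 0 := (Real.log_pos (by linarith [ht.1])).ne'
    field_simp
  rw [this, primeCnt, Chebyshev.primeCounting_eq_theta_div_log_add_integral hx,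
    Li_eq_div_log_add_integral hx]
  ring

theorem intervalIntegrable_primeCnt_div {x : ℝ} (hx : 2 ≤ x) :
    IntervalIntegrable (fun t ↦ (primeCnt t : ℝ) / t) volume 2 x := by
  have hmono : Monotone fun t ↦ (primeCnt t : ℝ) := fun a b hab ↦
    Nat.cast_le.mpr (Nat.monotone_primeCounting (Nat.floor_mono hab))
  refine hmono.intervalIntegrable.mul_continuousOn (g := fun t ↦ t⁻¹) ?_
  refine continuousOn_id.inv₀ fun t ht ↦ ?_
  rw [Set.uIcc_of_le hx] at ht
  exact (two_pos.trans_le ht.1).ne'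

theorem theta_sub_self_eq {x : ℝ} (hx : 2 ≤ x) :
    Chebyshev.theta x - x = ((primeCnt x : ℝ) - Li x) * Real.log x - 2 -
      ∫ t in (2:ℝ)..x, ((primeCnt t : ℝ) - Li t) / t := by
  have h3 := Li_mul_log_eq hx
  have h4 := Chebyshev.theta_eq_primeCounting_mul_log_sub_integral hx
  simp_rw [sub_div]
  rw [intervalIntegral.integral_sub (intervalIntegrable_primeCnt_div hx)
    (intervalIntegrable_Li_div hx), h4, sub_mul, h3]
  simp only [primeCnt]
  ring

theorem abs_theta_sub_self_le {t : ℝ} (ht : 2 ≤ t) :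
    |Chebyshev.theta t - t| ≤ (Real.log 4 + 1) * t := by
  have h0 := Chebyshev.theta_nonneg t
  have h1 := Chebyshev.theta_le_log4_mul_x (show 0 ≤ t by linarith)
  have h2 : 0 < Real.log 4 := Real.log_pos (by norm_num)
  have h3 : 0 ≤ Real.log 4 * t := by positivity
  rw [abs_le]
  constructor <;> linarith

theorem primeCounting_le_self (n : ℕ) : Nat.primeCounting n ≤ n := by
  rw [← Nat.primesLE_card_eq_primeCounting, Nat.primesLE_eq_filter_Icc_one]
  exact (card_filter_le _ _).trans (by simp)

theorem abs_primeCnt_sub_Li_le {t : ℝ} (ht : 2 ≤ t) :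
    |(primeCnt t : ℝ) - Li t| ≤ (1 + 1 / Real.log 2) * t := by
  have h0 : (0 : ℝ) ≤ primeCnt t := Nat.cast_nonneg _
  have h1 : (primeCnt t : ℝ) ≤ t :=
    (Nat.cast_le.mpr (primeCounting_le_self _)).trans (Nat.floor_le (by linarith))
  have h2 := Li_nonneg ht
  have h3 := Li_le ht
  rw [abs_le]
  constructor <;> linarith

theorem exists_abs_psi_sub_theta_le :
    ∃ D : ℝ, 0 < D ∧ ∀ x, |psi x - Chebyshev.theta x| ≤ D * √x := by
  obtain ⟨D, hD⟩ := Chebyshev.psi_sub_theta_le_mul_sqrt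
  refine ⟨|D| + 1, by positivity, fun x ↦ ?_⟩
  rw [psi_eq_chebyshev_psi, abs_of_nonneg (sub_nonneg.mpr (Chebyshev.theta_le_psi x))]
  refine (hD x).trans ?_
  gcongr
  linarith [le_abs_self D]

theorem abs_primeCnt_sub_Li_le_of_theta {K x : ℝ} (hK : 0 < K) (hx : 2 ≤ x)
    (h : ∀ t, 2 ≤ t → |Chebyshev.theta t - t| ≤ K * √t * Real.log t) :
    |(primeCnt x : ℝ) - Li x| ≤ K * √x + 2 / Real.log 2 + 2 * (K / Real.log 2) * √x := by
  have hl : 0 < Real.log 2 := Real.log_pos one_lt_two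
  have hlx : 0 < Real.log x := Real.log_pos (by linarith)
  rw [primeCnt_sub_Li_eq hx]
  refine (abs_add_le _ _).trans (add_le_add ((abs_add_le _ _).trans (add_le_add ?_ ?_)) ?_)
  · rw [abs_div, abs_of_pos hlx, div_le_iff₀ hlx]
    exact h x hx
  · rw [abs_of_pos (by positivity)]
  · refine abs_integral_le_two_mul_sqrt (by positivity) hx fun t ht _ ↦ ?_
    have ht0 : 0 < t := by linarith
    have hlt : Real.log 2 ≤ Real.log t := Real.log_le_log two_pos ht
    have hlt0 : 0 < Real.log t := hl.trans_le hlt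
    have hs : 0 < √t := Real.sqrt_pos.mpr ht0
    rw [abs_div, abs_of_pos (by positivity : 0 < t * Real.log t ^ 2)]
    calc |Chebyshev.theta t - t| / (t * Real.log t ^ 2)
        ≤ K * √t * Real.log t / (t * Real.log t ^ 2) := by gcongr; exact h t ht
      _ = K * √t * Real.log t / (√t * √t * Real.log t ^ 2) := by
        rw [Real.mul_self_sqrt ht0.le]
      _ = K / Real.log t / √t := by field_simp
      _ ≤ K / Real.log 2 / √t := by gcongr

theorem abs_theta_sub_self_le_of_primeCnt {K x : ℝ} (hK : 0 < K) (hx : 2 ≤ x)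
    (h : ∀ t, 2 ≤ t → |(primeCnt t : ℝ) - Li t| ≤ K * √t * Real.log t) :
    |Chebyshev.theta x - x| ≤
      K * √x * Real.log x * Real.log x + 2 + 2 * (K * Real.log x) * √x := by
  have hlx : 0 < Real.log x := Real.log_pos (by linarith)
  rw [theta_sub_self_eq hx]
  refine (abs_sub _ _).trans (add_le_add ((abs_sub _ _).trans (add_le_add ?_ ?_)) ?_)
  · rw [abs_mul, abs_of_pos hlx]
    gcongr
    exact h x hx
  · norm_num
  · refine abs_integral_le_two_mul_sqrt (by positivity) hx fun t ht htx ↦ ?_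
    have ht0 : 0 < t := by linarith
    have hs : 0 < √t := Real.sqrt_pos.mpr ht0
    rw [abs_div, abs_of_pos ht0]
    calc |(primeCnt t : ℝ) - Li t| / t ≤ K * √t * Real.log t / t := by gcongr; exact h t ht
      _ = K * √t * Real.log t / (√t * √t) := by rw [Real.mul_self_sqrt ht0.le]
      _ = K * Real.log t / √t := by field_simp
      _ ≤ K * Real.log x / √t := by gcongr

theorem vonKoch_equivalence :
    ((∃ C : ℝ, 0 < C ∧ ∃ x₀ : ℝ, ∀ x, x₀ ≤ x →
        |psi x - x| ≤ C * x ^ ((1:ℝ)/2) * Real.log x) →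
      (∃ C : ℝ, 0 < C ∧ ∃ x₀ : ℝ, ∀ x, x₀ ≤ x →
        |(primeCnt x : ℝ) - Li x| ≤ C * x ^ ((1:ℝ)/2) * Real.log x)) ∧
    ((∃ C : ℝ, 0 < C ∧ ∃ x₀ : ℝ, ∀ x, x₀ ≤ x →
        |(primeCnt x : ℝ) - Li x| ≤ C * x ^ ((1:ℝ)/2) * Real.log x) →
      (∃ C : ℝ, 0 < C ∧ ∃ x₀ : ℝ, ∀ x, x₀ ≤ x →
        |psi x - x| ≤ C * x ^ ((1:ℝ)/2) * (Real.log x) ^ 2)) := by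
  obtain ⟨D, hD, hDx⟩ := exists_abs_psi_sub_theta_le
  have hl : 0 < Real.log 2 := Real.log_pos one_lt_two
  have hlog : ∀ x, Real.exp 1 ≤ x → 2 ≤ x ∧ 1 ≤ Real.log x ∧ 1 ≤ √x := fun x hx ↦ by
    have h2 : 2 ≤ x := by linarith [Real.add_one_le_exp 1]
    exact ⟨h2, (Real.le_log_iff_exp_le (by linarith)).mpr hx,
      Real.one_le_sqrt.mpr (by linarith)⟩
  constructor
  · rintro ⟨C, hC, x₀, h⟩
    obtain ⟨K, hK, hKt⟩ := exists_forall_two_le_abs_le (f := fun t ↦ Chebyshev.theta t - t)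
      (fun t ht ↦ abs_theta_sub_self_le ht) ⟨C + D, by positivity, max x₀ (Real.exp 1), fun x hx ↦ by
        obtain ⟨-, hx1, hxs⟩ := hlog x ((le_max_right _ _).trans hx)
        have h1 := h x ((le_max_left _ _).trans hx)
        have h2 := hDx x
        rw [abs_sub_comm] at h2
        rw [← Real.sqrt_eq_rpow] at h1 ⊢
        have h3 : D * √x * 1 ≤ D * √x * Real.log x := by gcongr
        have h4 := abs_sub_le (Chebyshev.theta x) (psi x) x
        linarith⟩
    refine ⟨K + 2 / Real.log 2 + 2 * (K / Real.log 2), by positivity, Real.exp 1, fun x hx ↦ ?_⟩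
    obtain ⟨hx2, hx1, hxs⟩ := hlog x hx
    rw [← Real.sqrt_eq_rpow]
    calc |(primeCnt x : ℝ) - Li x|
        ≤ K * √x + 2 / Real.log 2 * 1 + 2 * (K / Real.log 2) * √x := by
          rw [mul_one]; exact abs_primeCnt_sub_Li_le_of_theta hK hx2 hKt
      _ ≤ K * √x + 2 / Real.log 2 * √x + 2 * (K / Real.log 2) * √x := by gcongr
      _ = (K + 2 / Real.log 2 + 2 * (K / Real.log 2)) * √x * 1 := by ring
      _ ≤ _ := by gcongr
  · intro h
    obtain ⟨K, hK, hKt⟩ := exists_forall_two_le_abs_le (fun t ht ↦ abs_primeCnt_sub_Li_le ht) h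
    refine ⟨D + 3 * K + 2, by positivity, Real.exp 1, fun x hx ↦ ?_⟩
    obtain ⟨hx2, hx1, hxs⟩ := hlog x hx
    have hl2 : 1 ≤ Real.log x ^ 2 := one_le_pow₀ hx1
    have hll : Real.log x ≤ Real.log x ^ 2 := le_self_pow₀ hx1 two_ne_zero
    rw [← Real.sqrt_eq_rpow]
    calc |psi x - x| ≤ |psi x - Chebyshev.theta x| + |Chebyshev.theta x - x| := abs_sub_le _ _ _
      _ ≤ D * √x * 1 + (K * √x * Real.log x * Real.log x + 2 * 1 * 1
            + 2 * (K * Real.log x) * √x) := by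
          rw [mul_one, mul_one, mul_one]
          exact add_le_add (hDx x) (abs_theta_sub_self_le_of_primeCnt hK hx2 hKt)
      _ ≤ D * √x * Real.log x ^ 2 + (K * √x * Real.log x * Real.log x + 2 * √x * Real.log x ^ 2
            + 2 * (K * Real.log x ^ 2) * √x) := by gcongr
      _ = (D + 3 * K + 2) * √x * Real.log x ^ 2 := by ring
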